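/- Let m be an odd positive integer, p an even positive integer, and g a natural number. Let G = S_p ≀ S_m be the wreath product, realized as the subgroup of permutations of Fin p × Fin m consisting of all σ for which there exist a permutation ρ of Fin p and a function τ : Fin p → S_m with σ(i, j) = (ρ(i), τ(i)(j)). Then the evaluated cycle index of G at the substitution x(k) = 0 for k odd and x(k) = −2g for k even satisfies Z(S_p ≀ S_m; 0, −2g, 0, −2g, …) = (−1)^{p/2} · Ring.choose((1/2)·C(2g, m), p/2), where C(2g, m) is the ordinary binomial coefficient and the outer generalized binomial coefficient is taken in ℚ. -/

import Mathlib

/- `cycCount π k` is the number of cycles of length `k` in the cycle decomposition of the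
permutation `π` of a finite type, where fixed points are counted as cycles of length `1`. -/
def cycCount {α : Type*} [Fintype α] [DecidableEq α] (π : Equiv.Perm α) (k : ℕ) : ℕ :=
  if k = 1 then Fintype.card α - π.support.card else π.cycleType.count k

/- The evaluated cycle index `Z(G; x)` of a subgroup `G` of the permutations of a finite
type `α`: `(1/|G|) · Σ_{π ∈ G} Π_{k=1}^{card α} x(k)^{c_k(π)}`. -/
open scoped Classical in
noncomputable def cycleIndex {α : Type*} [Fintype α] [DecidableEq α]
    (G : Subgroup (Equiv.Perm α)) (x : ℕ → ℚ) : ℚ :=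
  (1 / (Nat.card G : ℚ)) *
    ∑ π ∈ Finset.univ.filter (fun π => π ∈ G),
      ∏ k ∈ Finset.Icc 1 (Fintype.card α), x k ^ cycCount π k

/- The wreath product `S_k ≀ H`, realized as the subgroup of the permutations of
`Fin k × Fin m` consisting of all `σ` for which there exist a permutation `ρ` of `Fin k`
and a function `τ : Fin k → H` with `σ (i, j) = (ρ i, τ i j)` for all `(i, j)`. -/
def wreath (k m : ℕ) (H : Subgroup (Equiv.Perm (Fin m))) :
    Subgroup (Equiv.Perm (Fin k × Fin m)) where
  carrier := {σ | ∃ (ρ : Equiv.Perm (Fin k)) (τ : Fin k → H),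
    ∀ i j, σ (i, j) = (ρ i, (τ i : Equiv.Perm (Fin m)) j)}
  one_mem' := ⟨1, fun _ => 1, fun _ _ => rfl⟩
  mul_mem' := by
    rintro σ₁ σ₂ ⟨ρ₁, τ₁, h₁⟩ ⟨ρ₂, τ₂, h₂⟩
    refine ⟨ρ₁ * ρ₂, fun i => τ₁ (ρ₂ i) * τ₂ i, fun i j => ?_⟩
    simp [Equiv.Perm.mul_apply, h₂, h₁]
  inv_mem' := by
    rintro σ ⟨ρ, τ, h⟩
    refine ⟨ρ⁻¹, fun i => (τ (ρ⁻¹ i))⁻¹, fun i j => ?_⟩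
    rw [Equiv.Perm.inv_def, Equiv.symm_apply_eq, h]
    simp

section CycleSums

variable {α : Type*} [Fintype α] [DecidableEq α]

open scoped Classical in
/-- The number of elements of a cycle of `π`, fixed points being cycles of length `1`. -/
noncomputable def orbitCard (π : Equiv.Perm α)
    (q : Quotient (Equiv.Perm.SameCycle.setoid π)) : ℕ :=
  (Finset.univ.filter fun a : α => Quotient.mk _ a = q).card

lemma prod_pow_cycCount (π : Equiv.Perm α) (x : ℕ → ℚ) :
    ∏ k ∈ Finset.Icc 1 (Fintype.card α), x k ^ cycCount π k =
      (π.cycleType.map x).prod * x 1 ^ (Fintype.card α - π.support.card) := by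
  have hparts : (π.cycleType.map x).prod * x 1 ^ (Fintype.card α - π.support.card) =
      (π.partition.parts.map x).prod := by
    simp [Equiv.Perm.parts_partition]
  rw [hparts, Finset.prod_multiset_map_count]
  have hcount : ∀ k, k ≠ 0 → cycCount π k = π.partition.parts.count k := by
    intro k hk
    have h1 : π.cycleType.count 1 = 0 :=
      Multiset.count_eq_zero.2 fun h => absurd (Equiv.Perm.one_lt_of_mem_cycleType h) (by simp)
    unfold cycCount
    rw [Equiv.Perm.parts_partition, Multiset.count_add, Multiset.count_replicate]
    split_ifs with h h' h'
    · subst h; simp [h1]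
    · exact absurd h.symm h'
    · exact absurd h'.symm h
    · simp
  rw [Finset.prod_congr rfl fun k hk => by
    rw [hcount k (by have := (Finset.mem_Icc.1 hk).1; omega)]]
  symm
  apply Finset.prod_subset
  · intro k hk
    rw [Multiset.mem_toFinset] at hk
    exact Finset.mem_Icc.2 ⟨π.partition.parts_pos hk, by
      conv_rhs => rw [← π.partition.parts_sum]
      exact Multiset.le_sum_of_mem hk⟩
  · intro k _ hk
    rw [Multiset.mem_toFinset] at hk
    rw [Multiset.count_eq_zero.2 hk, pow_zero]

omit [DecidableEq α] in
lemma orbitCard_of_fixed (π : Equiv.Perm α) (q : Quotient (Equiv.Perm.SameCycle.setoid π))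
    (hq : π q.out = q.out) : orbitCard π q = 1 := by
  classical
  unfold orbitCard
  rw [Finset.card_eq_one]
  refine ⟨q.out, ?_⟩
  ext a
  simp only [Finset.mem_filter, Finset.mem_univ, true_and, Finset.mem_singleton]
  constructor
  · intro h
    have hs : π.SameCycle a q.out := Quotient.exact (h.trans q.out_eq.symm)
    exact (hs.symm.eq_of_left hq).symm
  · rintro rfl
    exact q.out_eq

lemma orbitCard_of_not_fixed (π : Equiv.Perm α)
    (q : Quotient (Equiv.Perm.SameCycle.setoid π)) (hq : π q.out ≠ q.out) :
    orbitCard π q = (π.cycleOf q.out).support.card := by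
  classical
  unfold orbitCard
  congr 1
  ext a
  simp only [Finset.mem_filter, Finset.mem_univ, true_and]
  rw [Equiv.Perm.mem_support_cycleOf_iff' hq]
  constructor
  · intro h
    exact (Quotient.exact (h.trans q.out_eq.symm) : π.SameCycle a q.out).symm
  · intro h
    conv_rhs => rw [← q.out_eq]
    exact Quotient.sound h.symm

open scoped Classical in
lemma prod_orbitCard (π : Equiv.Perm α) (x : ℕ → ℚ) :
    ∏ q : Quotient (Equiv.Perm.SameCycle.setoid π), x (orbitCard π q) =
      (π.cycleType.map x).prod * x 1 ^ (Fintype.card α - π.support.card) := by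
  rw [← Finset.prod_filter_mul_prod_filter_not Finset.univ
    (fun q : Quotient (Equiv.Perm.SameCycle.setoid π) => π q.out ≠ q.out)]
  congr 1
  · rw [Equiv.Perm.cycleType_def, Multiset.map_map]
    change _ = ∏ c ∈ π.cycleFactorsFinset, x c.support.card
    refine Finset.prod_bij (fun q _ => π.cycleOf q.out) ?_ ?_ ?_ ?_
    · intro q hq
      rw [Equiv.Perm.cycleOf_mem_cycleFactorsFinset_iff, Equiv.Perm.mem_support]
      exact (Finset.mem_filter.1 hq).2
    · intro q hq q' hq' h
      have hs : π.SameCycle q.out q'.out :=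
        (Equiv.Perm.sameCycle_iff_cycleOf_eq_of_mem_support
          (Equiv.Perm.mem_support.2 (Finset.mem_filter.1 hq).2)
          (Equiv.Perm.mem_support.2 (Finset.mem_filter.1 hq').2)).2 h
      rw [← q.out_eq, ← q'.out_eq]
      exact Quotient.sound hs
    · intro c hc
      obtain ⟨a, ha⟩ := (Equiv.Perm.mem_cycleFactorsFinset_iff.1 hc).1.nonempty_support
      have hca : c = π.cycleOf a := Equiv.Perm.cycle_is_cycleOf ha hc
      have hs : π.SameCycle (Quotient.mk (Equiv.Perm.SameCycle.setoid π) a).out a :=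
        Quotient.mk_out (s := Equiv.Perm.SameCycle.setoid π) a
      refine ⟨Quotient.mk _ a, Finset.mem_filter.2 ⟨Finset.mem_univ _, ?_⟩, ?_⟩
      · rw [← Equiv.Perm.mem_support, ← Equiv.Perm.cycleOf_mem_cycleFactorsFinset_iff,
          hs.cycleOf_eq, ← hca]
        exact hc
      · rw [hs.cycleOf_eq, hca]
    · intro q hq
      rw [orbitCard_of_not_fixed π q (Finset.mem_filter.1 hq).2]
  · rw [Finset.prod_congr rfl fun q hq => by
      rw [orbitCard_of_fixed π q (not_not.1 (Finset.mem_filter.1 hq).2)], Finset.prod_const]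
    congr 1
    rw [← Finset.card_compl]
    refine Finset.card_bij (fun q _ => q.out) ?_ ?_ ?_
    · intro q hq
      simpa using hq
    · intro q _ q' _ h
      exact Quotient.out_injective h
    · intro a ha
      have ha' : π a = a := by simpa using ha
      have hs : π.SameCycle a (Quotient.mk (Equiv.Perm.SameCycle.setoid π) a).out :=
        (show π.SameCycle _ a from
          Quotient.mk_out (s := Equiv.Perm.SameCycle.setoid π) a).symm
      have he := (hs.eq_of_left ha').symm
      refine ⟨Quotient.mk _ a, ?_, he⟩
      simp [he, ha']

lemma sign_eq_prod_orbitCard (π : Equiv.Perm α)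
    [Fintype (Quotient (Equiv.Perm.SameCycle.setoid π))] :
    ((Equiv.Perm.sign π : ℤ) : ℚ) =
      ∏ q : Quotient (Equiv.Perm.SameCycle.setoid π), -(-1 : ℚ) ^ orbitCard π q := by
  classical
  have h := prod_orbitCard π (fun k => -(-1 : ℚ) ^ k)
  convert h.symm using 1
  · rw [Equiv.Perm.sign_of_cycleType']
    simp only [pow_one, neg_neg, one_pow, mul_one]
    induction π.cycleType using Multiset.induction_on with
    | empty => simp
    | cons a s ih => simp [ih]
  · congr!

/-- The sum over the colourings fixed by `π` of their weights factors over the cycles. -/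
lemma sum_fixed_eq_prod_orbitCard {V : Type*} [Fintype V] [DecidableEq V] (π : Equiv.Perm α)
    [Fintype (Quotient (Equiv.Perm.SameCycle.setoid π))] (ε : V → ℚ) :
    ∑ f : α → V with (f ∘ π = f), ∏ a, ε (f a) =
      ∏ q : Quotient (Equiv.Perm.SameCycle.setoid π), ∑ v, ε v ^ orbitCard π q := by
  classical
  rw [Finset.prod_univ_sum, Fintype.piFinset_univ]
  symm
  refine Finset.sum_bij (fun h _ a => h (Quotient.mk _ a)) ?_ ?_ ?_ ?_
  · intro h _
    refine Finset.mem_filter.2 ⟨Finset.mem_univ _, ?_⟩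
    funext a
    exact congrArg h (Quotient.sound
      (Equiv.Perm.sameCycle_apply_left.2 (Equiv.Perm.SameCycle.refl π a)))
  · intro h _ h' _ e
    funext q
    induction q using Quotient.inductionOn with
    | h a => exact congrFun e a
  · intro f hf
    have hf' : ∀ a, f (π a) = f a := congrFun (Finset.mem_filter.1 hf).2
    have hz : ∀ (n : ℤ) a, f ((π ^ n) a) = f a := by
      intro n
      induction n with
      | zero => simp
      | succ n ih => intro a; rw [zpow_add_one, Equiv.Perm.mul_apply, ih, hf']
      | pred n ih =>
        intro a
        rw [zpow_sub_one, Equiv.Perm.mul_apply, ih, ← hf' (π⁻¹ a)]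
        simp
    refine ⟨Quotient.lift f ?_, Finset.mem_univ _, rfl⟩
    rintro a b ⟨n, rfl⟩
    exact (hz n a).symm
  · intro h _
    rw [← Finset.prod_fiberwise Finset.univ
      (fun a : α => Quotient.mk (Equiv.Perm.SameCycle.setoid π) a)]
    refine Finset.prod_congr rfl fun q _ => ?_
    rw [Finset.prod_congr rfl fun a ha => congrArg (fun q => ε (h q)) (Finset.mem_filter.1 ha).2,
      Finset.prod_const, orbitCard]

/-- The signed power sum substitution in the cycle index monomial of `π` counts the colourings
fixed by `π`, with weights. -/
lemma prod_pow_cycCount_eq_sign_mul_sum {V : Type*} [Fintype V] [DecidableEq V] (ε : V → ℚ)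
    (π : Equiv.Perm α) :
    ∏ k ∈ Finset.Icc 1 (Fintype.card α), (-(-1 : ℚ) ^ k * ∑ v, ε v ^ k) ^ cycCount π k =
      ((Equiv.Perm.sign π : ℤ) : ℚ) * ∑ f : α → V with (f ∘ π = f), ∏ a, ε (f a) := by
  classical
  rw [prod_pow_cycCount π (fun k => -(-1 : ℚ) ^ k * ∑ v, ε v ^ k), ← prod_orbitCard,
    sign_eq_prod_orbitCard, sum_fixed_eq_prod_orbitCard, Finset.prod_mul_distrib]

end CycleSums

section StabilizerSums

variable {α V : Type*} [Fintype α] [DecidableEq α] [DecidableEq V]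

open scoped Classical in
/-- The signed power sum evaluation of the cycle index as a weighted sum over colourings of the
sums of signs over their stabilizers. -/
lemma cycleIndex_signed_powerSum [Fintype V] (G : Subgroup (Equiv.Perm α)) (ε : V → ℚ) :
    cycleIndex G (fun k => -(-1 : ℚ) ^ k * ∑ v, ε v ^ k) =
      (1 / (Nat.card G : ℚ)) * ∑ f : α → V, (∏ a, ε (f a)) *
        ∑ π : Equiv.Perm α with (π ∈ G ∧ f ∘ π = f), ((Equiv.Perm.sign π : ℤ) : ℚ) := by
  unfold cycleIndex
  congr 1
  rw [Finset.sum_congr rfl fun π _ => prod_pow_cycCount_eq_sign_mul_sum ε π]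
  simp only [Finset.mul_sum]
  rw [Finset.sum_comm' (t' := Finset.univ)
    (s' := fun f : α → V => Finset.univ.filter fun π => π ∈ G ∧ f ∘ π = f)]
  · exact Finset.sum_congr rfl fun f _ => Finset.sum_congr rfl fun π _ => mul_comm _ _
  · simp

open scoped Classical in
lemma sum_sign_stabilizer_eq_zero (G : Subgroup (Equiv.Perm α)) (f : α → V)
    (s : Equiv.Perm α) (hs : s ∈ G) (hf : f ∘ s = f) (hsign : Equiv.Perm.sign s = -1) :
    ∑ π : Equiv.Perm α with (π ∈ G ∧ f ∘ π = f), ((Equiv.Perm.sign π : ℤ) : ℚ) = 0 := by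
  have h : ∑ π : Equiv.Perm α with (π ∈ G ∧ f ∘ π = f), ((Equiv.Perm.sign π : ℤ) : ℚ) =
      ∑ π : Equiv.Perm α with (π ∈ G ∧ f ∘ π = f), -((Equiv.Perm.sign π : ℤ) : ℚ) := by
    refine Finset.sum_equiv (Equiv.mulLeft s) ?_ ?_
    · intro π
      have hc : f ∘ ⇑(s * π) = f ∘ π := by
        rw [Equiv.Perm.coe_mul, ← Function.comp_assoc, hf]
      simp only [Finset.mem_filter, Finset.mem_univ, true_and, Equiv.coe_mulLeft, hc,
        Subgroup.mul_mem_cancel_left G hs]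
    · intro π _
      simp [hsign]
  rw [Finset.sum_neg_distrib] at h
  linarith

open scoped Classical in
lemma sum_sign_stabilizer_eq_one (G : Subgroup (Equiv.Perm α)) (f : α → V)
    (h : ∀ π ∈ G, f ∘ π = f → π = 1) :
    ∑ π : Equiv.Perm α with (π ∈ G ∧ f ∘ π = f), ((Equiv.Perm.sign π : ℤ) : ℚ) = 1 := by
  have : (Finset.univ.filter fun π : Equiv.Perm α => π ∈ G ∧ f ∘ π = f) = {1} := by
    ext π
    simp only [Finset.mem_filter, Finset.mem_univ, true_and, Finset.mem_singleton]
    refine ⟨fun hπ => h π hπ.1 hπ.2, ?_⟩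
    rintro rfl
    exact ⟨G.one_mem, rfl⟩
  simp [this]

end StabilizerSums

section WreathColourings

variable {V : Type*} [DecidableEq V] {p m : ℕ}

/-- The set of colours used in the block `i`. -/
def blockImage (f : Fin p × Fin m → V) (i : Fin p) : Finset V :=
  Finset.univ.image fun j => f (i, j)

/-- The collection of the colour sets of the blocks. -/
def blockImages (f : Fin p × Fin m → V) : Finset (Finset V) :=
  Finset.univ.image (blockImage f)

lemma mem_wreath_top_iff {σ : Equiv.Perm (Fin p × Fin m)} :
    σ ∈ wreath p m (⊤ : Subgroup (Equiv.Perm (Fin m))) ↔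
      ∃ (ρ : Equiv.Perm (Fin p)) (τ : Fin p → Equiv.Perm (Fin m)),
        ∀ i j, σ (i, j) = (ρ i, τ i j) :=
  ⟨fun ⟨ρ, τ, h⟩ => ⟨ρ, fun i => τ i, h⟩, fun ⟨ρ, τ, h⟩ => ⟨ρ, fun i => ⟨τ i, trivial⟩, h⟩⟩

lemma blockImage_comp (f : Fin p × Fin m → V) {σ : Equiv.Perm (Fin p × Fin m)}
    {ρ : Equiv.Perm (Fin p)} {τ : Fin p → Equiv.Perm (Fin m)}
    (h : ∀ i j, σ (i, j) = (ρ i, τ i j)) (i : Fin p) :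
    blockImage (f ∘ σ) i = blockImage f (ρ i) := by
  ext v
  simp only [blockImage, Finset.mem_image, Finset.mem_univ, true_and, Function.comp, h]
  exact (τ i).exists_congr_left.trans (by simp)

lemma blockImages_comp (f : Fin p × Fin m → V) {σ : Equiv.Perm (Fin p × Fin m)}
    (h : σ ∈ wreath p m (⊤ : Subgroup (Equiv.Perm (Fin m)))) :
    blockImages (f ∘ σ) = blockImages f := by
  obtain ⟨ρ, τ, h⟩ := mem_wreath_top_iff.1 h
  ext S
  simp only [blockImages, Finset.mem_image, Finset.mem_univ, true_and, blockImage_comp f h]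
  exact ρ.exists_congr_left.trans (by simp)

/-- A colouring is good when it is injective on each block and distinct blocks use distinct sets
of colours. -/
def GoodColouring (f : Fin p × Fin m → V) : Prop :=
  Function.Injective (blockImage f) ∧ ∀ i, Function.Injective fun j => f (i, j)

lemma goodColouring_iff [Fintype V] (f : Fin p × Fin m → V) :
    GoodColouring f ↔
      blockImages f ∈ Finset.powersetCard p (Finset.powersetCard m Finset.univ) := by
  have hA : ∀ i, (blockImage f i).card = m ↔ Function.Injective fun j => f (i, j) := by
    intro i
    simpa [blockImage] using Finset.card_image_iff (s := Finset.univ) (f := fun j => f (i, j))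
  have hB : (blockImages f).card = p ↔ Function.Injective (blockImage f) := by
    simpa [blockImages] using Finset.card_image_iff (s := Finset.univ) (f := blockImage f)
  have hC : blockImages f ⊆ Finset.powersetCard m Finset.univ ↔
      ∀ i, (blockImage f i).card = m := by
    simp [Finset.subset_iff, blockImages]
  rw [Finset.mem_powersetCard, hB, hC, GoodColouring, and_comm]
  simp only [hA]

lemma GoodColouring.eq_one_of_comp_eq {f : Fin p × Fin m → V} (hf : GoodColouring f)
    {σ : Equiv.Perm (Fin p × Fin m)}
    (hσ : σ ∈ wreath p m (⊤ : Subgroup (Equiv.Perm (Fin m)))) (h : f ∘ σ = f) : σ = 1 := by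
  obtain ⟨ρ, τ, hστ⟩ := mem_wreath_top_iff.1 hσ
  have hρ : ∀ i, ρ i = i := fun i => hf.1 (by rw [← blockImage_comp f hστ, h])
  have hτ : ∀ i j, τ i j = j := fun i j => hf.2 i (by
    have := congrFun h (i, j)
    rwa [Function.comp, hστ, hρ] at this)
  ext1 ⟨i, j⟩
  rw [hστ, hρ, hτ, Equiv.Perm.one_apply]

lemma GoodColouring.exists_comp_eq {f f' : Fin p × Fin m → V}
    (hf' : GoodColouring f') (h : blockImages f' = blockImages f) :
    ∃ σ ∈ wreath p m (⊤ : Subgroup (Equiv.Perm (Fin m))), f ∘ σ = f' := by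
  have h1 : ∀ i, ∃ i', blockImage f i' = blockImage f' i := by
    intro i
    have : blockImage f' i ∈ blockImages f := h ▸ Finset.mem_image_of_mem _ (Finset.mem_univ i)
    simpa [blockImages] using this
  choose ρ hρ using h1
  have h2 : ∀ i j, ∃ j', f (ρ i, j') = f' (i, j) := by
    intro i j
    have : f' (i, j) ∈ blockImage f (ρ i) :=
      hρ i ▸ Finset.mem_image_of_mem (fun j => f' (i, j)) (Finset.mem_univ j)
    simpa [blockImage] using this
  choose τ hτ using h2
  have hρi : Function.Injective ρ := fun i i' e => hf'.1 (by rw [← hρ, ← hρ, e])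
  have hτi : ∀ i, Function.Injective (τ i) := fun i j j' e => hf'.2 i (by
    change f' (i, j) = f' (i, j')
    rw [← hτ, ← hτ, e])
  let ρ' : Equiv.Perm (Fin p) := Equiv.ofBijective ρ (Finite.injective_iff_bijective.1 hρi)
  let τ' : Fin p → Equiv.Perm (Fin m) := fun i =>
    Equiv.ofBijective (τ i) (Finite.injective_iff_bijective.1 (hτi i))
  have hσi : Function.Injective fun x : Fin p × Fin m => (ρ x.1, τ x.1 x.2) := by
    rintro ⟨i, j⟩ ⟨i', j'⟩ e
    obtain ⟨e1, e2⟩ := Prod.ext_iff.1 e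
    obtain rfl := hρi e1
    obtain rfl := hτi i e2
    rfl
  refine ⟨Equiv.ofBijective _ (Finite.injective_iff_bijective.1 hσi),
    mem_wreath_top_iff.2 ⟨ρ', τ', fun _ _ => rfl⟩, ?_⟩
  funext ⟨i, j⟩
  exact hτ i j

lemma exists_blockImages_eq [Fintype V] {T : Finset (Finset V)}
    (hT : T ∈ Finset.powersetCard p (Finset.powersetCard m Finset.univ)) :
    ∃ f : Fin p × Fin m → V, blockImages f = T := by
  obtain ⟨hTm, hTp⟩ := Finset.mem_powersetCard.1 hT
  let e := T.equivFinOfCardEq hTp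
  have hc : ∀ S ∈ T, S.card = m := fun S hS => (Finset.mem_powersetCard.1 (hTm hS)).2
  let d : ∀ S : T, S.1 ≃ Fin m := fun S => S.1.equivFinOfCardEq (hc S.1 S.2)
  let f : Fin p × Fin m → V := fun x => (d (e.symm x.1)).symm x.2
  have hb : ∀ i, blockImage f i = (e.symm i).1 := by
    intro i
    ext v
    simp only [blockImage, Finset.mem_image, Finset.mem_univ, true_and]
    constructor
    · rintro ⟨j, rfl⟩
      exact ((d (e.symm i)).symm j).2
    · intro hv
      exact ⟨d (e.symm i) ⟨v, hv⟩, by simp [f]⟩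
  refine ⟨f, ?_⟩
  ext S
  simp only [blockImages, Finset.mem_image, Finset.mem_univ, true_and, hb]
  constructor
  · rintro ⟨i, rfl⟩
    exact (e.symm i).2
  · intro hS
    exact ⟨e ⟨S, hS⟩, by simp⟩

lemma card_filter_blockImages_eq [Fintype V] {T : Finset (Finset V)}
    (hT : T ∈ Finset.powersetCard p (Finset.powersetCard m Finset.univ)) :
    (Finset.univ.filter fun f : Fin p × Fin m → V => blockImages f = T).card =
      Nat.card (wreath p m (⊤ : Subgroup (Equiv.Perm (Fin m)))) := by
  classical
  obtain ⟨f, rfl⟩ := exists_blockImages_eq hT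
  have hf := (goodColouring_iff f).2 hT
  rw [Nat.card_eq_fintype_card, ← Finset.card_univ]
  symm
  refine Finset.card_bij (fun σ _ => f ∘ σ.1) ?_ ?_ ?_
  · intro σ _
    simp [blockImages_comp f σ.2]
  · intro σ _ σ' _ e
    have h1 : f ∘ ⇑(σ.1 * σ'.1⁻¹) = f := by
      rw [Equiv.Perm.coe_mul, ← Function.comp_assoc, e, Function.comp_assoc,
        ← Equiv.Perm.coe_mul, mul_inv_cancel, Equiv.Perm.coe_one, Function.comp_id]
    exact Subtype.ext (mul_inv_eq_one.1
      (hf.eq_one_of_comp_eq (Subgroup.mul_mem _ σ.2 (Subgroup.inv_mem _ σ'.2)) h1))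
  · intro f' hf'
    have hf'' := (Finset.mem_filter.1 hf').2
    obtain ⟨σ, hσ, h⟩ := ((goodColouring_iff f').2 (hf'' ▸ hT)).exists_comp_eq hf''
    exact ⟨⟨σ, hσ⟩, Finset.mem_univ _, h⟩

lemma GoodColouring.prod_eq {f : Fin p × Fin m → V} (hf : GoodColouring f) (ε : V → ℚ) :
    ∏ x, ε (f x) = ∏ S ∈ blockImages f, ∏ v ∈ S, ε v := by
  rw [blockImages, Finset.prod_image hf.1.injOn, Fintype.prod_prod_type]
  refine Finset.prod_congr rfl fun i _ => ?_
  rw [blockImage, Finset.prod_image (hf.2 i).injOn]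

lemma prodCongrRight_mem_wreath (τ : Fin p → Equiv.Perm (Fin m)) :
    Equiv.prodCongrRight τ ∈ wreath p m (⊤ : Subgroup (Equiv.Perm (Fin m))) :=
  mem_wreath_top_iff.2 ⟨1, τ, fun _ _ => rfl⟩

lemma prodCongrLeft_const_mem_wreath (ρ : Equiv.Perm (Fin p)) :
    (Equiv.prodCongrLeft fun _ : Fin m => ρ) ∈
      wreath p m (⊤ : Subgroup (Equiv.Perm (Fin m))) :=
  mem_wreath_top_iff.2 ⟨ρ, fun _ => 1, fun _ _ => rfl⟩

omit [DecidableEq V] in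
lemma exists_odd_of_not_injective {f : Fin p × Fin m → V} {i : Fin p}
    (hf : ¬ Function.Injective fun j => f (i, j)) :
    ∃ s ∈ wreath p m (⊤ : Subgroup (Equiv.Perm (Fin m))),
      f ∘ s = f ∧ Equiv.Perm.sign s = -1 := by
  obtain ⟨j, j', he, hj⟩ := Function.not_injective_iff.1 hf
  refine ⟨_, prodCongrRight_mem_wreath (Function.update 1 i (Equiv.swap j j')), ?_, ?_⟩
  · funext ⟨a, b⟩
    simp only [Function.comp, Equiv.prodCongrRight_apply]
    rcases eq_or_ne a i with rfl | ha
    · rw [Function.update_self]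
      rcases eq_or_ne b j with rfl | hb
      · rw [Equiv.swap_apply_left]
        exact he.symm
      rcases eq_or_ne b j' with rfl | hb'
      · rw [Equiv.swap_apply_right]
        exact he
      · rw [Equiv.swap_apply_of_ne_of_ne hb hb']
    · rw [Function.update_of_ne ha]
      rfl
  · rw [Equiv.Perm.sign_prodCongrRight, Finset.prod_eq_single i]
    · rw [Function.update_self, Equiv.Perm.sign_swap hj]
    · intro a _ ha
      rw [Function.update_of_ne ha, Pi.one_apply, Equiv.Perm.sign_one]
    · simp

/-- For blocks of odd size, two injectively coloured blocks with the same set of colours can be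
swapped by an odd permutation preserving the colouring. -/
lemma exists_odd_of_blockImage_eq (hm : Odd m) {f : Fin p × Fin m → V} {i i' : Fin p}
    (hi : i ≠ i') (hf : blockImage f i = blockImage f i')
    (hinj : Function.Injective fun j => f (i', j)) :
    ∃ s ∈ wreath p m (⊤ : Subgroup (Equiv.Perm (Fin m))),
      f ∘ s = f ∧ Equiv.Perm.sign s = -1 := by
  have h2 : ∀ j, ∃ j', f (i, j') = f (i', j) := by
    intro j
    have : f (i', j) ∈ blockImage f i :=
      hf ▸ Finset.mem_image_of_mem (fun j => f (i', j)) (Finset.mem_univ j)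
    simpa [blockImage] using this
  choose t ht using h2
  have hti : Function.Injective t := fun j j' e => hinj (by
    change f (i', j) = f (i', j')
    rw [← ht, ← ht, e])
  let τ : Equiv.Perm (Fin m) := Equiv.ofBijective t (Finite.injective_iff_bijective.1 hti)
  let θ : Equiv.Perm (Fin p × Fin m) := Equiv.prodCongrRight (Function.update 1 i τ)
  let w : Equiv.Perm (Fin p × Fin m) := Equiv.prodCongrLeft fun _ => Equiv.swap i i'
  have hθi : ∀ j, f (θ (i, j)) = f (i', j) := by
    intro j
    simp only [θ, Equiv.prodCongrRight_apply, Function.update_self]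
    exact ht j
  have hθ : ∀ a, a ≠ i → ∀ j, f (θ (a, j)) = f (a, j) := by
    intro a ha j
    simp only [θ, Equiv.prodCongrRight_apply, Function.update_of_ne ha]
    rfl
  have hw : ∀ x, f (θ (w x)) = f (θ x) := by
    rintro ⟨a, b⟩
    simp only [w, Equiv.prodCongrLeft_apply]
    rcases eq_or_ne a i with rfl | ha
    · rw [Equiv.swap_apply_left, hθi, hθ _ hi.symm]
    rcases eq_or_ne a i' with rfl | ha'
    · rw [Equiv.swap_apply_right, hθi, hθ _ hi.symm]
    · rw [Equiv.swap_apply_of_ne_of_ne ha ha']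
  refine ⟨θ * w * θ⁻¹, ?_, ?_, ?_⟩
  · exact mul_mem (mul_mem (prodCongrRight_mem_wreath _) (prodCongrLeft_const_mem_wreath _))
      (inv_mem (prodCongrRight_mem_wreath _))
  · funext x
    simp only [Function.comp, Equiv.Perm.mul_apply, hw]
    rw [← Equiv.Perm.mul_apply, mul_inv_cancel, Equiv.Perm.one_apply]
  · have hsw : Equiv.Perm.sign w = -1 := by
      simp only [w, Equiv.Perm.sign_prodCongrLeft, Equiv.Perm.sign_swap hi, Finset.prod_const,
        Finset.card_univ, Fintype.card_fin, hm.neg_one_pow]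
    simp [hsw]

lemma exists_odd_of_not_good (hm : Odd m) {f : Fin p × Fin m → V} (hf : ¬ GoodColouring f) :
    ∃ s ∈ wreath p m (⊤ : Subgroup (Equiv.Perm (Fin m))),
      f ∘ s = f ∧ Equiv.Perm.sign s = -1 := by
  by_cases hinj : ∀ i, Function.Injective fun j => f (i, j)
  · have h : ¬ Function.Injective (blockImage f) := fun h => hf ⟨h, hinj⟩
    obtain ⟨i, i', he, hi⟩ := Function.not_injective_iff.1 h
    exact exists_odd_of_blockImage_eq hm hi he (hinj i')
  · obtain ⟨i, hi⟩ := not_forall.1 hinj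
    exact exists_odd_of_not_injective hi

/-- For blocks of odd size, the signed power sum evaluation of the cycle index of the wreath
product of two full symmetric groups is a composition of elementary symmetric sums. -/
lemma cycleIndex_wreath_signed_powerSum [Fintype V] (hm : Odd m) (ε : V → ℚ) :
    cycleIndex (wreath p m (⊤ : Subgroup (Equiv.Perm (Fin m))))
        (fun k => -(-1 : ℚ) ^ k * ∑ v, ε v ^ k) =
      ∑ T ∈ Finset.powersetCard p (Finset.powersetCard m (Finset.univ : Finset V)),
        ∏ S ∈ T, ∏ v ∈ S, ε v := by
  classical
  set P := Finset.powersetCard p (Finset.powersetCard m (Finset.univ : Finset V)) with hP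
  have hterm : ∀ f : Fin p × Fin m → V, (∏ a, ε (f a)) *
      ∑ π : Equiv.Perm (Fin p × Fin m) with
        (π ∈ wreath p m (⊤ : Subgroup (Equiv.Perm (Fin m))) ∧ f ∘ π = f),
        ((Equiv.Perm.sign π : ℤ) : ℚ) =
      if blockImages f ∈ P then ∏ S ∈ blockImages f, ∏ v ∈ S, ε v else 0 := by
    intro f
    split_ifs with h
    · have hf := (goodColouring_iff f).2 h
      rw [sum_sign_stabilizer_eq_one _ f fun π hπ => hf.eq_one_of_comp_eq hπ, mul_one,
        hf.prod_eq]
    · obtain ⟨s, hs, hfs, hsign⟩ :=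
        exists_odd_of_not_good hm fun hf => h ((goodColouring_iff f).1 hf)
      rw [sum_sign_stabilizer_eq_zero _ f s hs hfs hsign, mul_zero]
  rw [cycleIndex_signed_powerSum, Finset.sum_congr rfl fun f _ => by convert hterm f,
    ← Finset.sum_filter,
    ← Finset.sum_fiberwise_of_maps_to (t := P) (g := blockImages)
      fun f hf => (Finset.mem_filter.1 hf).2, Finset.mul_sum]
  refine Finset.sum_congr rfl fun T hT => ?_
  have hfib : (Finset.univ.filter fun f : Fin p × Fin m → V => blockImages f ∈ P).filter
      (fun f => blockImages f = T) = Finset.univ.filter fun f => blockImages f = T := by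
    ext f
    simp only [Finset.mem_filter, Finset.mem_univ, true_and, and_iff_right_iff_imp]
    rintro rfl
    exact hT
  rw [hfib, Finset.sum_congr rfl fun f hf => by rw [(Finset.mem_filter.1 hf).2],
    Finset.sum_const, card_filter_blockImages_eq hT, nsmul_eq_mul, ← mul_assoc,
    one_div_mul_cancel (Nat.cast_ne_zero.2 Nat.card_pos.ne'), one_mul]

end WreathColourings

section Balanced

open Polynomial

lemma prod_one_add_C_mul_X_of_balanced {ι : Type*} (s : Finset ι) (e : ι → ℚ) (φ : ι → ι)
    (hφs : ∀ i ∈ s, φ i ∈ s) (hφ : ∀ i, φ (φ i) = i) (he : ∀ i ∈ s, e i = 1 ∨ e i = -1)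
    (hneg : ∀ i ∈ s, e (φ i) = -e i) :
    ∃ n, s.card = 2 * n ∧ ∏ i ∈ s, (1 + C (e i) * X) = (1 - X ^ 2 : ℚ[X]) ^ n := by
  have hcard : (s.filter fun i => ¬ e i = 1).card = (s.filter fun i => e i = 1).card := by
    refine Finset.card_bij' (fun i _ => φ i) (fun i _ => φ i) ?_ ?_
      (fun i _ => hφ i) (fun i _ => hφ i)
    · intro i hi
      obtain ⟨his, hi1⟩ := Finset.mem_filter.1 hi
      exact Finset.mem_filter.2 ⟨hφs i his, by
        rw [hneg i his, (he i his).resolve_left hi1, neg_neg]⟩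
    · intro i hi
      obtain ⟨his, hi1⟩ := Finset.mem_filter.1 hi
      exact Finset.mem_filter.2 ⟨hφs i his, by rw [hneg i his, hi1]; norm_num⟩
  refine ⟨(s.filter fun i => e i = 1).card, ?_, ?_⟩
  · rw [← Finset.card_filter_add_card_filter_not (s := s) (fun i => e i = 1), hcard, two_mul]
  · rw [← Finset.prod_filter_mul_prod_filter_not s (fun i => e i = 1),
      Finset.prod_congr rfl (g := fun _ => (1 + X : ℚ[X])) fun i hi => by
        rw [(Finset.mem_filter.1 hi).2, C_1, one_mul],
      Finset.prod_congr (s₁ := s.filter fun i => ¬ e i = 1) rfl (g := fun _ => (1 - X : ℚ[X]))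
        fun i hi => by
          obtain ⟨his, hi1⟩ := Finset.mem_filter.1 hi
          rw [(he i his).resolve_left hi1, C_neg, C_1, neg_one_mul, sub_eq_add_neg],
      Finset.prod_const, Finset.prod_const, hcard, ← mul_pow]
    congr 1
    ring

lemma coeff_one_sub_X_sq_pow (n j : ℕ) :
    ((1 - X ^ 2 : ℚ[X]) ^ n).coeff (j * 2) = (-1) ^ j * (n.choose j : ℚ) := by
  have h : (1 - X ^ 2 : ℚ[X]) ^ n = expand ℚ 2 ((1 + C (-1) * X) ^ n) := by
    simp [sub_eq_add_neg]
  have h2 : ((1 + C (-1) * X : ℚ[X]) ^ n) = ((1 + X) ^ n).comp (C (-1) * X) := by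
    simp
  rw [h, coeff_expand_mul (by norm_num), h2, comp_C_mul_X_coeff, coeff_one_add_X_pow, mul_comm]

/-- The elementary symmetric sums of a family of as many ones as minus ones. -/
lemma sum_powersetCard_prod_of_balanced {ι : Type*} (s : Finset ι) (e : ι → ℚ) (φ : ι → ι)
    (hφs : ∀ i ∈ s, φ i ∈ s) (hφ : ∀ i, φ (φ i) = i) (he : ∀ i ∈ s, e i = 1 ∨ e i = -1)
    (hneg : ∀ i ∈ s, e (φ i) = -e i) (j : ℕ) :
    ∑ T ∈ Finset.powersetCard (j * 2) s, ∏ i ∈ T, e i =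
      (-1 : ℚ) ^ j * Ring.choose ((1 / 2 : ℚ) * (s.card : ℚ)) j := by
  classical
  obtain ⟨n, hn, hprod⟩ := prod_one_add_C_mul_X_of_balanced s e φ hφs hφ he hneg
  have hhalf : (1 / 2 : ℚ) * (s.card : ℚ) = (n : ℚ) := by
    rw [hn]
    push_cast
    ring
  rw [hhalf, Ring.choose_natCast, ← coeff_one_sub_X_sq_pow, ← hprod, Finset.prod_one_add,
    finsetSum_coeff, Finset.powersetCard_eq_filter, Finset.sum_filter]
  refine Finset.sum_congr rfl fun T _ => ?_
  rw [Finset.prod_mul_distrib, Finset.prod_const, ← map_prod, coeff_C_mul, coeff_X_pow, mul_ite,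
    mul_one, mul_zero]
  simp only [eq_comm]

end Balanced

/-- for `m` odd positive and `p` even positive,
`Z(S_p ≀ S_m; 0, −2g, 0, −2g, …) = (−1)^{p/2} · Ring.choose((1/2)·C(2g, m), p/2)`. -/
theorem cycleIndex_wreath_symm_odd_even (m p g : ℕ) (hm : Odd m) (hm0 : 0 < m)
    (hp : Even p) (hp0 : 0 < p) :
    cycleIndex (wreath p m (⊤ : Subgroup (Equiv.Perm (Fin m))))
        (fun k => if Odd k then 0 else -(2 * g : ℚ)) =
      (-1 : ℚ) ^ (p / 2) *
        Ring.choose ((1 / 2 : ℚ) * ((2 * g).choose m : ℚ)) (p / 2) := by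
  let ε : Fin g ⊕ Fin g → ℚ := Sum.elim (fun _ => 1) (fun _ => -1)
  have hx : (fun k : ℕ => if Odd k then 0 else -(2 * g : ℚ)) =
      fun k => -(-1 : ℚ) ^ k * ∑ v, ε v ^ k := by
    funext k
    split_ifs with hk
    · simp [ε, hk.neg_one_pow]
    · simp [ε, (Nat.not_odd_iff_even.1 hk).neg_one_pow]
      ring
  have hpj : p = p / 2 * 2 := (Nat.div_mul_cancel hp.two_dvd).symm
  have hcard : (Finset.powersetCard m (Finset.univ : Finset (Fin g ⊕ Fin g))).card =
      (2 * g).choose m := by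
    simp [two_mul]
  rw [hx, cycleIndex_wreath_signed_powerSum hm, ← hcard]
  conv_lhs => rw [hpj]
  refine sum_powersetCard_prod_of_balanced _ (fun S => ∏ v ∈ S, ε v)
    (fun S => S.map (Equiv.sumComm _ _).toEmbedding) ?_ ?_ ?_ ?_ _
  · intro S hS
    simpa using hS
  · intro S
    ext v
    simp
  · intro S _
    refine Finset.prod_induction ε (fun a => a = 1 ∨ a = -1) ?_ (Or.inl rfl) ?_
    · rintro a b (rfl | rfl) (rfl | rfl) <;> norm_num
    · rintro (v | v) _ <;> simp [ε]
  · intro S hS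
    have hsw : ∀ v, ε ((Equiv.sumComm (Fin g) (Fin g)) v) = -1 * ε v := by
      rintro (v | v) <;> simp [ε]
    simp only [Finset.prod_map, Equiv.coe_toEmbedding, hsw, Finset.prod_mul_distrib,
      Finset.prod_const, (Finset.mem_powersetCard.1 hS).2, hm.neg_one_pow]
    exact neg_one_mul _
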